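/- arXiv:1611.05442 — 2 statements merged into one kernel-verified Lean document; each statement's English description precedes it below -/
import Mathlib

section
/- Let U = [[A_U, B_U],[C_U, D_U]] and V = [[A_V, B_V],[C_V, D_V]] be complex block matrices with blocks of matching sizes. Suppose R(C_V) ⊆ R(D_V) and R(B_Uᴴ) ⊆ R(D_Uᴴ). If (U, V) is a Moore-Penrose inverse absorbing pair, then (D_U, D_V) is also a Moore-Penrose inverse absorbing pair. -/
open Matrix

/-- `X` is the Moore-Penrose inverse of `A`. -/
def IsMoorePenrose {m n : Type*} [Fintype m] [Fintype n]
    (A : Matrix m n ℂ) (X : Matrix n m ℂ) : Prop :=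
  A * X * A = A ∧ X * A * X = X ∧ (A * X)ᴴ = A * X ∧ (X * A)ᴴ = X * A

/-- The column space (range) of a complex matrix. -/
noncomputable def colSpace {m n : Type*} [Fintype n] (A : Matrix m n ℂ) :
    Submodule ℂ (m → ℂ) :=
  LinearMap.range A.mulVecLin

/-- Range inclusion is the same as a factorization; here the direction that produces the factor. -/
theorem exists_eq_mul_of_colSpace_le {m n k : Type*} [Fintype n] [Fintype k]
    {C : Matrix m n ℂ} {D : Matrix m k ℂ} (h : colSpace C ≤ colSpace D) :
    ∃ W : Matrix k n ℂ, C = D * W := by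
  classical
  have key (j : n) : ∃ w : k → ℂ, D *ᵥ w = C.col j :=
    h ⟨Pi.single j 1, by simp⟩
  choose w hw using key
  exact ⟨Matrix.of fun i j => w j i, Matrix.ext fun i j => (congrFun (hw j) i).symm⟩

/-- The absorbing identity for Moore-Penrose inverses says that the column space of `A` lies in
that of `B` and the row space of `B` lies in that of `A`. -/
theorem IsMoorePenrose.add_eq_mul_add_mul_iff {m n : Type*} [Fintype m] [Fintype n]
    {A B : Matrix m n ℂ} {X Y : Matrix n m ℂ}
    (hA : IsMoorePenrose A X) (hB : IsMoorePenrose B Y) :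
    X + Y = X * (A + B) * Y ↔ B * Y * A = A ∧ B * X * A = B := by
  obtain ⟨a1, a2, a3, a4⟩ := hA
  obtain ⟨b1, b2, b3, b4⟩ := hB
  constructor
  · intro h
    rw [Matrix.mul_add, Matrix.add_mul] at h
    have hX : X * B * Y = X := by
      have := congrArg (X * A * ·) h
      simp only [Matrix.mul_add, ← Matrix.mul_assoc, a2] at this
      rw [add_comm] at this
      exact (add_left_cancel this).symm
    have hY : X * A * Y = Y := by
      rw [hX, add_comm] at h
      exact (add_right_cancel h).symm
    constructor
    · have hX' : B * Y * Xᴴ = Xᴴ := by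
        rw [← b3, ← conjTranspose_mul, ← Matrix.mul_assoc, hX]
      have hA' : A = Xᴴ * Aᴴ * A := by
        rw [← conjTranspose_mul, a3, a1]
      calc B * Y * A = B * Y * (Xᴴ * Aᴴ * A) := by rw [← hA']
        _ = B * Y * Xᴴ * Aᴴ * A := by simp only [Matrix.mul_assoc]
        _ = A := by rw [hX', ← hA']
    · have hY' : Yᴴ * (X * A) = Yᴴ := by
        rw [← a4, ← conjTranspose_mul, hY]
      have hB' : B = B * (Bᴴ * Yᴴ) := by
        rw [← conjTranspose_mul, b4, ← Matrix.mul_assoc, b1]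
      calc B * X * A = B * (Bᴴ * Yᴴ) * X * A := by rw [← hB']
        _ = B * (Bᴴ * (Yᴴ * (X * A))) := by simp only [Matrix.mul_assoc]
        _ = B := by rw [hY', ← hB']
  · rintro ⟨h1, h2⟩
    have hX : X * B * Y = X := by
      have hA' : Aᴴ * (B * Y) = Aᴴ := by
        rw [← b3, ← conjTranspose_mul, h1]
      have hX' : X = X * (Xᴴ * Aᴴ) := by
        rw [← conjTranspose_mul, a3, ← Matrix.mul_assoc, a2]
      calc X * B * Y = X * (Xᴴ * Aᴴ) * B * Y := by rw [← hX']
        _ = X * (Xᴴ * (Aᴴ * (B * Y))) := by simp only [Matrix.mul_assoc]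
        _ = X := by rw [hA', ← hX']
    have hY : X * A * Y = Y := by
      have hB' : X * A * Bᴴ = Bᴴ := by
        rw [← a4, ← conjTranspose_mul, ← Matrix.mul_assoc, h2]
      have hY' : Y = Bᴴ * Yᴴ * Y := by
        rw [← conjTranspose_mul, b4, b2]
      calc X * A * Y = X * A * (Bᴴ * Yᴴ * Y) := by rw [← hY']
        _ = X * A * Bᴴ * Yᴴ * Y := by simp only [Matrix.mul_assoc]
        _ = Y := by rw [hB', ← hY']
    rw [Matrix.mul_add, Matrix.add_mul, hX, hY, add_comm]

theorem inheritance_trailing_block_moore_penrose_absorbing {m n p s : ℕ}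
    (AU : Matrix (Fin m) (Fin n) ℂ) (BU : Matrix (Fin m) (Fin p) ℂ)
    (CU : Matrix (Fin s) (Fin n) ℂ) (DU : Matrix (Fin s) (Fin p) ℂ)
    (AV : Matrix (Fin m) (Fin n) ℂ) (BV : Matrix (Fin m) (Fin p) ℂ)
    (CV : Matrix (Fin s) (Fin n) ℂ) (DV : Matrix (Fin s) (Fin p) ℂ)
    (DUp DVp : Matrix (Fin p) (Fin s) ℂ)
    (hDU : IsMoorePenrose DU DUp) (hDV : IsMoorePenrose DV DVp)
    (Up Vp : Matrix (Fin n ⊕ Fin p) (Fin m ⊕ Fin s) ℂ)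
    (hU : IsMoorePenrose (Matrix.fromBlocks AU BU CU DU) Up)
    (hV : IsMoorePenrose (Matrix.fromBlocks AV BV CV DV) Vp)
    (h1 : colSpace CV ≤ colSpace DV)
    (h2 : colSpace BUᴴ ≤ colSpace DUᴴ)
    (habs : Up + Vp =
      Up * (Matrix.fromBlocks AU BU CU DU + Matrix.fromBlocks AV BV CV DV) * Vp) :
    DUp + DVp = DUp * (DU + DV) * DVp := by
  obtain ⟨W, rfl⟩ := exists_eq_mul_of_colSpace_le h1
  obtain ⟨Z, hZ⟩ := exists_eq_mul_of_colSpace_le h2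
  have hBU : BU = Zᴴ * DU := by
    rw [← conjTranspose_conjTranspose BU, hZ, conjTranspose_mul, conjTranspose_conjTranspose]
  obtain ⟨hVU, hUV⟩ := (hU.add_eq_mul_add_mul_iff hV).1 habs
  rw [hDU.add_eq_mul_add_mul_iff hDV]
  constructor
  · obtain ⟨K, hK⟩ : ∃ K : Matrix (Fin p) (Fin p) ℂ, DU = DV * K := by
      rw [Matrix.mul_assoc, ← fromBlocks_toBlocks (Vp * _), fromBlocks_multiply,
        fromBlocks_inj] at hVU
      exact ⟨_, by rw [← hVU.2.2.2, Matrix.mul_assoc, ← Matrix.mul_add]⟩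
    rw [hK, ← Matrix.mul_assoc, hDV.1]
  · obtain ⟨K, hK⟩ : ∃ K : Matrix (Fin s) (Fin s) ℂ, DV = K * DU := by
      rw [← fromBlocks_toBlocks (_ * Up), fromBlocks_multiply, fromBlocks_inj] at hUV
      have h := hUV.2.2.2
      generalize toBlocks₂₁ _ = P at h
      generalize toBlocks₂₂ _ = Q at h
      exact ⟨P * Zᴴ + Q, by rw [← h, hBU, Matrix.add_mul, Matrix.mul_assoc]⟩
    rw [hK, Matrix.mul_assoc, Matrix.mul_assoc, ← Matrix.mul_assoc DU, hDU.1]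
end

section
/- Let U = [[A_U, B_U],[C_U, D_U]] and V = [[A_V, B_V],[C_V, D_V]] be complex block matrices with blocks of matching sizes. Suppose R(C_Uᴴ) ⊆ R(A_Uᴴ), R(B_U) ⊆ R(A_U), R(B_Uᴴ) ⊆ R(D_Uᴴ), R(C_U) ⊆ R(D_U), R(C_Vᴴ) ⊆ R(A_Vᴴ), R(B_V) ⊆ R(A_V), R(B_Vᴴ) ⊆ R(D_Vᴴ) and R(C_V) ⊆ R(D_V), and suppose A_U and A_V are range symmetric. If (U, V) is a Moore-Penrose inverse absorbing pair, then (H_U, H_V) is also a Moore-Penrose inverse absorbing pair, where H_U = [[A_U⁺, −A_U⁺ B_U],[C_U A_U⁺, F_U]] with F_U = D_U − C_U A_U⁺ B_U, and H_V = [[A_V⁺, −A_V⁺ B_V],[C_V A_V⁺, F_V]] with F_V = D_V − C_V A_V⁺ B_V. -/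
open Matrix

section ColSpace

variable {k l m n : Type*}

theorem colSpace_mul_le [Fintype l] [Fintype n] (A : Matrix m n ℂ) (B : Matrix n l ℂ) :
    colSpace (A * B) ≤ colSpace A := by
  rintro _ ⟨v, rfl⟩
  exact ⟨B *ᵥ v, by simp⟩

variable [Fintype l] [Fintype n]

theorem colSpace_le_iff_exists_eq_mul {A : Matrix m n ℂ} {B : Matrix m l ℂ} :
    colSpace A ≤ colSpace B ↔ ∃ W : Matrix l n ℂ, A = B * W := by
  classical
  constructor
  · intro h
    have hcol (j : n) : ∃ w : l → ℂ, B *ᵥ w = A.col j := by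
      obtain ⟨w, hw⟩ := h ⟨Pi.single j 1, rfl⟩
      exact ⟨w, by simpa using hw⟩
    choose w hw using hcol
    refine ⟨Matrix.of fun i j => w j i, ?_⟩
    ext i j
    exact (congrFun (hw j) i).symm
  · rintro ⟨W, rfl⟩
    exact colSpace_mul_le B W

variable [Fintype k]

theorem colSpace_fromBlocks_diagonal_le {A A' : Matrix n n ℂ} {D : Matrix m l ℂ}
    {D' : Matrix m k ℂ} (hA : colSpace A ≤ colSpace A') (hD : colSpace D ≤ colSpace D') :
    colSpace (fromBlocks A 0 0 D) ≤ colSpace (fromBlocks A' 0 0 D') := by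
  obtain ⟨S, rfl⟩ := colSpace_le_iff_exists_eq_mul.1 hA
  obtain ⟨T, rfl⟩ := colSpace_le_iff_exists_eq_mul.1 hD
  refine colSpace_le_iff_exists_eq_mul.2 ⟨fromBlocks S 0 0 T, ?_⟩
  simp [fromBlocks_multiply]

theorem colSpace_diagonal_blocks_le {A A' : Matrix n n ℂ} {B B' : Matrix n l ℂ}
    {C C' : Matrix m n ℂ} {D D' : Matrix m l ℂ}
    (h : colSpace (fromBlocks A B C D) ≤ colSpace (fromBlocks A' B' C' D'))
    (hB : colSpace B' ≤ colSpace A') (hC : colSpace C' ≤ colSpace D') :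
    colSpace A ≤ colSpace A' ∧ colSpace D ≤ colSpace D' := by
  obtain ⟨W, hW⟩ := colSpace_le_iff_exists_eq_mul.1 h
  obtain ⟨S, rfl⟩ := colSpace_le_iff_exists_eq_mul.1 hB
  obtain ⟨T, rfl⟩ := colSpace_le_iff_exists_eq_mul.1 hC
  rw [← fromBlocks_toBlocks W, fromBlocks_multiply, fromBlocks_inj] at hW
  obtain ⟨hA, -, -, hD⟩ := hW
  constructor <;> apply colSpace_le_iff_exists_eq_mul.2
  · exact ⟨W.toBlocks₁₁ + S * W.toBlocks₂₁, by rw [hA, Matrix.mul_add, Matrix.mul_assoc]⟩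
  · exact ⟨T * W.toBlocks₁₂ + W.toBlocks₂₂, by rw [hD, Matrix.mul_add, Matrix.mul_assoc]⟩

/-- The range of a pivot transform is that of its diagonal part `diag(P, D)`. -/
theorem colSpace_pivot {P : Matrix n n ℂ} {B : Matrix n l ℂ} {C : Matrix m n ℂ}
    {D : Matrix m l ℂ} (hC : colSpace C ≤ colSpace D) :
    colSpace (fromBlocks P (-(P * B)) (C * P) (D - C * P * B)) =
      colSpace (fromBlocks P 0 0 D) := by
  classical
  obtain ⟨T, rfl⟩ := colSpace_le_iff_exists_eq_mul.1 hC
  apply le_antisymm <;> apply colSpace_le_iff_exists_eq_mul.2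
  · refine ⟨fromBlocks 1 (-B) (T * P) (1 - T * P * B), ?_⟩
    simp [fromBlocks_multiply, Matrix.mul_sub, Matrix.mul_assoc]
  · refine ⟨fromBlocks (1 - B * (T * P)) B (-(T * P)) 1, ?_⟩
    simp [fromBlocks_multiply, Matrix.mul_sub, Matrix.sub_mul, Matrix.mul_assoc]

end ColSpace

namespace IsMoorePenrose

variable {m n : Type*} [Fintype m] [Fintype n] {A B : Matrix m n ℂ} {X Y : Matrix n m ℂ}

theorem conjTranspose (h : IsMoorePenrose A X) : IsMoorePenrose Aᴴ Xᴴ := by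
  obtain ⟨h1, h2, h3, h4⟩ := h
  refine ⟨?_, ?_, ?_, ?_⟩
  · simpa [Matrix.mul_assoc] using congrArg Matrix.conjTranspose h1
  · simpa [Matrix.mul_assoc] using congrArg Matrix.conjTranspose h2
  · rw [← conjTranspose_mul, h4, h4]
  · rw [← conjTranspose_mul, h3, h3]

theorem mul_mul_conjTranspose (h : IsMoorePenrose A X) : X * A * Aᴴ = Aᴴ := by
  rw [← h.2.2.2, ← conjTranspose_mul, ← Matrix.mul_assoc, h.1]

theorem conjTranspose_mul_mul (h : IsMoorePenrose A X) : Aᴴ * (A * X) = Aᴴ := by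
  rw [← h.2.2.1, ← conjTranspose_mul, h.1]

theorem eq_conjTranspose_mul (h : IsMoorePenrose A X) : X = Aᴴ * (Xᴴ * X) := by
  rw [← Matrix.mul_assoc, ← conjTranspose_mul, h.2.2.2, h.2.1]

theorem eq_mul_conjTranspose (h : IsMoorePenrose A X) : X = X * Xᴴ * Aᴴ := by
  rw [Matrix.mul_assoc, ← conjTranspose_mul, h.2.2.1, ← Matrix.mul_assoc, h.2.1]

theorem colSpace_eq (h : IsMoorePenrose A X) : colSpace X = colSpace Aᴴ := by
  apply le_antisymm <;> apply colSpace_le_iff_exists_eq_mul.2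
  · exact ⟨_, h.eq_conjTranspose_mul⟩
  · exact ⟨A * Aᴴ, by rw [← Matrix.mul_assoc, h.mul_mul_conjTranspose]⟩

/-- A pair is absorbing iff the ranges and the row spaces are nested in opposite directions. -/
theorem absorbing_iff (hA : IsMoorePenrose A X) (hB : IsMoorePenrose B Y) :
    X + Y = X * (A + B) * Y ↔ colSpace A ≤ colSpace B ∧ colSpace Bᴴ ≤ colSpace Aᴴ := by
  constructor
  · intro h
    have hX : X = X * (B * Y) := by
      have h' := congrArg (X * A * ·) h
      have e : X * A * (X * (A + B) * Y) = X * A * Y + X * (B * Y) := by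
        rw [← Matrix.mul_assoc, ← Matrix.mul_assoc, hA.2.1, Matrix.mul_add, Matrix.add_mul,
          Matrix.mul_assoc X B]
      simp only [Matrix.mul_add (X * A), hA.2.1, e] at h'
      rw [add_comm] at h'
      exact add_left_cancel h'
    have hY : Y = X * (A * Y) := by
      rw [Matrix.mul_add, Matrix.add_mul, Matrix.mul_assoc X B, ← hX, add_comm,
        Matrix.mul_assoc] at h
      exact add_right_cancel h
    constructor
    · have e : colSpace Xᴴ = colSpace A := by
        simpa using hA.conjTranspose.colSpace_eq
      rw [← e, hX, conjTranspose_mul, hB.2.2.1, Matrix.mul_assoc]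
      exact colSpace_mul_le _ _
    · rw [← hA.colSpace_eq, ← hB.colSpace_eq, hY]
      exact colSpace_mul_le _ _
  · rintro ⟨h1, h2⟩
    obtain ⟨W, hW⟩ := colSpace_le_iff_exists_eq_mul.1 h1
    obtain ⟨Z, hZ⟩ := colSpace_le_iff_exists_eq_mul.1 h2
    have hX : X * B * Y = X := by
      have e : X = X * Xᴴ * Wᴴ * Bᴴ := by
        rw [Matrix.mul_assoc _ Wᴴ, ← conjTranspose_mul, ← hW, ← hA.eq_mul_conjTranspose]
      calc X * B * Y = X * Xᴴ * Wᴴ * (Bᴴ * (B * Y)) := by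
            rw [← Matrix.mul_assoc (X * Xᴴ * Wᴴ), ← e, Matrix.mul_assoc]
        _ = X := by rw [hB.conjTranspose_mul_mul, ← e]
    have hY : X * A * Y = Y := by
      have e : Y = Aᴴ * (Z * (Yᴴ * Y)) := by
        rw [← Matrix.mul_assoc Aᴴ, ← hZ, ← hB.eq_conjTranspose_mul]
      calc X * A * Y = X * A * Aᴴ * (Z * (Yᴴ * Y)) := by rw [Matrix.mul_assoc _ Aᴴ, ← e]
        _ = Y := by rw [hA.mul_mul_conjTranspose, ← e]
    rw [Matrix.mul_add, Matrix.add_mul, hX, hY, add_comm]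

end IsMoorePenrose

theorem inheritance_pppt_moore_penrose_absorbing {n p s : ℕ}
    (AU : Matrix (Fin n) (Fin n) ℂ) (BU : Matrix (Fin n) (Fin p) ℂ)
    (CU : Matrix (Fin s) (Fin n) ℂ) (DU : Matrix (Fin s) (Fin p) ℂ)
    (AV : Matrix (Fin n) (Fin n) ℂ) (BV : Matrix (Fin n) (Fin p) ℂ)
    (CV : Matrix (Fin s) (Fin n) ℂ) (DV : Matrix (Fin s) (Fin p) ℂ)
    (AUp AVp : Matrix (Fin n) (Fin n) ℂ)
    (hAU : IsMoorePenrose AU AUp) (hAV : IsMoorePenrose AV AVp)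
    (Up Vp : Matrix (Fin n ⊕ Fin p) (Fin n ⊕ Fin s) ℂ)
    (hU : IsMoorePenrose (Matrix.fromBlocks AU BU CU DU) Up)
    (hV : IsMoorePenrose (Matrix.fromBlocks AV BV CV DV) Vp)
    (HUp HVp : Matrix (Fin n ⊕ Fin p) (Fin n ⊕ Fin s) ℂ)
    (hHU : IsMoorePenrose
      (Matrix.fromBlocks AUp (-(AUp * BU)) (CU * AUp) (DU - CU * AUp * BU)) HUp)
    (hHV : IsMoorePenrose
      (Matrix.fromBlocks AVp (-(AVp * BV)) (CV * AVp) (DV - CV * AVp * BV)) HVp)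
    (h1 : colSpace CUᴴ ≤ colSpace AUᴴ) (h2 : colSpace BU ≤ colSpace AU)
    (h3 : colSpace BUᴴ ≤ colSpace DUᴴ) (h4 : colSpace CU ≤ colSpace DU)
    (h5 : colSpace CVᴴ ≤ colSpace AVᴴ) (h6 : colSpace BV ≤ colSpace AV)
    (h7 : colSpace BVᴴ ≤ colSpace DVᴴ) (h8 : colSpace CV ≤ colSpace DV)
    (hrsU : colSpace AUᴴ = colSpace AU) (hrsV : colSpace AVᴴ = colSpace AV)
    (habs : Up + Vp =
      Up * (Matrix.fromBlocks AU BU CU DU + Matrix.fromBlocks AV BV CV DV) * Vp) :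
    HUp + HVp = HUp *
      (Matrix.fromBlocks AUp (-(AUp * BU)) (CU * AUp) (DU - CU * AUp * BU) +
        Matrix.fromBlocks AVp (-(AVp * BV)) (CV * AVp) (DV - CV * AVp * BV)) * HVp := by
  obtain ⟨hUV, hVU⟩ := (hU.absorbing_iff hV).1 habs
  rw [fromBlocks_conjTranspose, fromBlocks_conjTranspose] at hVU
  obtain ⟨hA, hD⟩ := colSpace_diagonal_blocks_le hUV h6 h8
  obtain ⟨hA', hD'⟩ := colSpace_diagonal_blocks_le hVU h1 h3
  have pivot_conjTranspose (P : Matrix (Fin n) (Fin n) ℂ) (B : Matrix (Fin n) (Fin p) ℂ)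
      (C : Matrix (Fin s) (Fin n) ℂ) (D : Matrix (Fin s) (Fin p) ℂ)
      (hB : colSpace Bᴴ ≤ colSpace Dᴴ) :
      colSpace (fromBlocks P (-(P * B)) (C * P) (D - C * P * B))ᴴ =
        colSpace (fromBlocks Pᴴ 0 0 Dᴴ) := by
    have hB' : colSpace (-Bᴴ) ≤ colSpace Dᴴ := by
      obtain ⟨W, hW⟩ := colSpace_le_iff_exists_eq_mul.1 hB
      exact colSpace_le_iff_exists_eq_mul.2 ⟨-W, by rw [hW, Matrix.mul_neg]⟩
    rw [← colSpace_pivot (P := Pᴴ) (B := -Cᴴ) hB', fromBlocks_conjTranspose]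
    simp [Matrix.mul_assoc]
  refine (hHU.absorbing_iff hHV).2 ⟨?_, ?_⟩
  · rw [colSpace_pivot h4, colSpace_pivot h8]
    refine colSpace_fromBlocks_diagonal_le ?_ hD
    rwa [hAU.colSpace_eq, hAV.colSpace_eq, hrsU, hrsV]
  · rw [pivot_conjTranspose _ _ _ _ h3, pivot_conjTranspose _ _ _ _ h7]
    refine colSpace_fromBlocks_diagonal_le ?_ hD'
    rw [hAU.conjTranspose.colSpace_eq, hAV.conjTranspose.colSpace_eq]
    simpa only [conjTranspose_conjTranspose, hrsU, hrsV] using hA'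
end
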